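/- No minimal Lorentzian surface in 𝔼⁴₁ has null 2-type Gauss map (Corollary 4.4): in the setting of a minimal Lorentzian surface x(s,t) = α(s) + β(t) in null coordinates with I₁ × I₂ connected, there do not exist smooth maps ν₁, ν₂ : I₁ × I₂ → Λ²(ℝ⁴) and a real constant λ ≠ 0 such that ν = ν₁ + ν₂ (possibly after subtracting a constant bivector ν₀, i.e. ν = ν₀ + ν₁ + ν₂ with ν₀ constant), Δν₁ = 0 with ν₁ non-constant, and Δν₂ = λ·ν₂ with ν₂ non-constant, where Δξ := (2/m²)·∂²ξ/∂s∂t. -/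

import Mathlib

noncomputable section

/-- The Minkowski bilinear form on `ℝ⁴ = Fin 4 → ℝ`:
`B(v,w) = -v₀w₀ + v₁w₁ + v₂w₂ + v₃w₃`. -/
def B4 (v w : Fin 4 → ℝ) : ℝ :=
  -(v 0 * w 0) + v 1 * w 1 + v 2 * w 2 + v 3 * w 3

/-- The wedge product `v ∧ w`, modelled concretely as the antisymmetric array
`(i,j) ↦ vᵢwⱼ - vⱼwᵢ` (a faithful model of the second exterior power `Λ²(ℝ⁴)`). -/
def wedge (v w : Fin 4 → ℝ) : Fin 4 → Fin 4 → ℝ :=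
  fun i j => v i * w j - v j * w i

/-- Partial derivative of a two-parameter map with respect to the first variable. -/
def pds {E : Type*} [NormedAddCommGroup E] [NormedSpace ℝ E]
    (x : ℝ → ℝ → E) (s t : ℝ) : E :=
  deriv (fun u => x u t) s

/-- Partial derivative of a two-parameter map with respect to the second variable. -/
def pdt {E : Type*} [NormedAddCommGroup E] [NormedSpace ℝ E]
    (x : ℝ → ℝ → E) (s t : ℝ) : E :=
  deriv (fun u => x s u) t

/-- `m²(s,t) = -B(α'(s), β'(t))`, the conformal factor of the induced metric
`-m²(ds⊗dt + dt⊗ds)` of the minimal Lorentzian surface `x(s,t) = α(s) + β(t)`. -/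
def msq (α β : ℝ → Fin 4 → ℝ) (s t : ℝ) : ℝ :=
  -B4 (deriv α s) (deriv β t)

/-- `η₁ = h(∂s,∂s)`: the component of `x_{ss} = α''` orthogonal to the tangent
plane `span{α'(s), β'(t)}`. -/
def eta1 (α β : ℝ → Fin 4 → ℝ) (s t : ℝ) : Fin 4 → ℝ :=
  deriv (deriv α) s
    - (B4 (deriv (deriv α) s) (deriv β t) / B4 (deriv α s) (deriv β t)) • deriv α s

/-- `η₂ = h(∂t,∂t)`: the component of `x_{tt} = β''` orthogonal to the tangent
plane `span{α'(s), β'(t)}`. -/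
def eta2 (α β : ℝ → Fin 4 → ℝ) (s t : ℝ) : Fin 4 → ℝ :=
  deriv (deriv β) t
    - (B4 (deriv (deriv β) t) (deriv α s) / B4 (deriv α s) (deriv β t)) • deriv β t

/-- The Gauss map `ν = (1/m²)·(α'(s) ∧ β'(t))`, valued in (a model of) `Λ²(ℝ⁴)`. -/
def gaussMap (α β : ℝ → Fin 4 → ℝ) (s t : ℝ) : Fin 4 → Fin 4 → ℝ :=
  (1 / msq α β s t) • wedge (deriv α s) (deriv β t)

/-- The Laplace–Beltrami operator of the induced metric `-m²(ds⊗dt + dt⊗ds)`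
(with the sign convention of the paper) acting on `Λ²(ℝ⁴)`-valued maps:
`Δξ = (2/m²)·∂²ξ/∂s∂t`. -/
def lap (α β : ℝ → Fin 4 → ℝ) (ξ : ℝ → ℝ → (Fin 4 → Fin 4 → ℝ)) (s t : ℝ) :
    Fin 4 → Fin 4 → ℝ :=
  (2 / msq α β s t) • pds (pdt ξ) s t

theorem hasDerivAt_B4 {u v : ℝ → Fin 4 → ℝ} {u' v' : Fin 4 → ℝ} {s : ℝ}
    (hu : HasDerivAt u u' s) (hv : HasDerivAt v v' s) :
    HasDerivAt (fun x => B4 (u x) (v x)) (B4 u' (v s) + B4 (u s) v') s := by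
  have hu' := hasDerivAt_pi.1 hu
  have hv' := hasDerivAt_pi.1 hv
  unfold B4
  have := ((((hu' 0).mul (hv' 0)).neg.add ((hu' 1).mul (hv' 1))).add
    ((hu' 2).mul (hv' 2))).add ((hu' 3).mul (hv' 3))
  refine (this.congr_deriv ?_)
  ring

theorem hasDerivAt_B4_left {u : ℝ → Fin 4 → ℝ} {u' : Fin 4 → ℝ} {s : ℝ}
    (v : Fin 4 → ℝ) (hu : HasDerivAt u u' s) :
    HasDerivAt (fun x => B4 (u x) v) (B4 u' v) s := by
  have := hasDerivAt_B4 hu (hasDerivAt_const s v)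
  refine this.congr_deriv ?_
  simp [B4]

theorem hasDerivAt_B4_right {u : ℝ → Fin 4 → ℝ} {u' : Fin 4 → ℝ} {s : ℝ}
    (v : Fin 4 → ℝ) (hu : HasDerivAt u u' s) :
    HasDerivAt (fun x => B4 v (u x)) (B4 v u') s := by
  have := hasDerivAt_B4 (hasDerivAt_const s v) hu
  refine this.congr_deriv ?_
  simp [B4]

theorem B4_comm (v w : Fin 4 → ℝ) : B4 v w = B4 w v := by
  unfold B4; ring

/-- antisymmetric arrays killing three suitable vectors vanish -/
theorem antisym_kill (W : Fin 4 → Fin 4 → ℝ) (hW : ∀ i j, W i j = - W j i)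
    (a a1 a2 b : Fin 4 → ℝ) (hnull : B4 a a = 0) (h01 : B4 a a1 = 0)
    (h02 : B4 a a2 ≠ 0) (h11 : B4 a1 a1 ≠ 0) (hb : B4 a b ≠ 0)
    (k0 : ∀ i, B4 (W i) a = 0) (k1 : ∀ i, B4 (W i) a1 = 0) (k2 : ∀ i, B4 (W i) a2 = 0) :
    W = 0 := by
  by_contra hne
  have : ∃ i j, W i j ≠ 0 := by
    by_contra! h
    exact hne (by ext i j; simpa using h i j)
  obtain ⟨i, j, hij⟩ := this
  let e : Fin 4 → Fin 4 → ℝ := fun k l => if l = k then (if k = 0 then -1 else 1) else 0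
  have he : ∀ (u : Fin 4 → ℝ) k, B4 u (e k) = u k := by
    intro u k
    fin_cases k <;> simp [B4, e]
  have hii : ∀ i, W i i = 0 := fun i => by linarith [hW i i]
  have key : LinearIndependent ℝ ![a, a1, a2, e i, e j] := by
    rw [Fintype.linearIndependent_iff]
    intro g hg
    have hB : ∀ u : Fin 4 → ℝ, g 0 * B4 u a + g 1 * B4 u a1 + g 2 * B4 u a2 + g 3 * B4 u (e i)
        + g 4 * B4 u (e j) = 0 := by
      intro u
      have hl : ∀ l, g 0 * a l + g 1 * a1 l + g 2 * a2 l + g 3 * e i l + g 4 * e j l = 0 := by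
        intro l
        have := congrFun hg l
        simpa [Fin.sum_univ_succ, add_assoc] using this
      simp only [B4]
      linear_combination (-u 0) * hl 0 + u 1 * hl 1 + u 2 * hl 2 + u 3 * hl 3
    have g4 : g 4 = 0 := by
      have := hB (W i)
      rw [k0, k1, k2, he, he, hii] at this
      simpa [hij] using this
    have g3 : g 3 = 0 := by
      have := hB (W j)
      rw [k0, k1, k2, he, he, hii, hW j i] at this
      simpa [hij] using this
    have g2 : g 2 = 0 := by
      have := hB a
      rw [hnull, h01, g3, g4] at this
      simpa [h02] using this
    have g1 : g 1 = 0 := by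
      have := hB a1
      rw [B4_comm a1 a, h01, g2, g3, g4] at this
      simpa [h11] using this
    have g0 : g 0 = 0 := by
      have := hB b
      rw [B4_comm b a, g1, g2, g3, g4] at this
      simpa [hb] using this
    intro k
    fin_cases k <;> assumption
  have := key.fintype_card_le_finrank
  simp at this

theorem kill_family (I : Set ℝ) (hI : IsOpen I) (a a1 a2 : ℝ → Fin 4 → ℝ)
    (ha : ∀ s ∈ I, HasDerivAt a (a1 s) s) (ha1 : ∀ s ∈ I, HasDerivAt a1 (a2 s) s)
    (hnull : ∀ s ∈ I, B4 (a s) (a s) = 0) (b : Fin 4 → ℝ) (hb : ∀ s ∈ I, B4 (a s) b ≠ 0)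
    (h01 : ∀ s ∈ I, B4 (a s) (a1 s) = 0)
    (W : Fin 4 → Fin 4 → ℝ) (hW : ∀ i j, W i j = - W j i)
    (heig : ∀ s ∈ I, ∃ c, ∀ i, B4 (W i) (a s) = c * a s i)
    (s0 : ℝ) (hs0 : s0 ∈ I) (hq : B4 (a1 s0) (a1 s0) ≠ 0) : W = 0 := by
  let p : ℝ → ℝ := fun s => B4 (fun i => B4 (W i) (a s)) b / B4 (a s) b
  have hp : ∀ s ∈ I, ∀ i, B4 (W i) (a s) = p s * a s i := by
    intro s hs i
    obtain ⟨c, hc⟩ := heig s hs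
    have : p s = c := by
      have h1 : (fun i => B4 (W i) (a s)) = fun i => c * a s i := funext hc
      simp only [p]
      rw [h1, div_eq_iff (hb s hs)]
      simp only [B4]; ring
    rw [this, hc]
  have hpd : ∀ s ∈ I, DifferentiableAt ℝ p s := by
    intro s hs
    have h1 : HasDerivAt (fun s i => B4 (W i) (a s)) (fun i => B4 (W i) (a1 s)) s :=
      hasDerivAt_pi.2 fun i => hasDerivAt_B4_right _ (ha s hs)
    exact ((hasDerivAt_B4_left b h1).differentiableAt).div
      (hasDerivAt_B4_left b (ha s hs)).differentiableAt (hb s hs)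
  have hp0 : ∀ s ∈ I, p s * B4 (a1 s) (a1 s) = 0 := by
    intro s hs
    have hd : ∀ i, B4 (W i) (a1 s) = deriv p s * a s i + p s * a1 s i := by
      intro i
      have h1 := hasDerivAt_B4_right (W i) (ha s hs)
      have h2 := (hpd s hs).hasDerivAt.mul (hasDerivAt_pi.1 (ha s hs) i)
      refine h1.unique (h2.congr_of_eventuallyEq ?_)
      filter_upwards [hI.mem_nhds hs] with x hx using hp x hx i
    have h3 := h01 s hs
    have d0 := hd 0
    have d1 := hd 1
    have d2 := hd 2
    have d3 := hd 3
    simp only [B4] at *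
    have w00 := hW 0 0
    have w11 := hW 1 1
    have w22 := hW 2 2
    have w33 := hW 3 3
    have w10 := hW 1 0
    have w20 := hW 2 0
    have w30 := hW 3 0
    have w21 := hW 2 1
    have w31 := hW 3 1
    have w32 := hW 3 2
    have e00 : W 0 0 = 0 := by linarith
    have e11 : W 1 1 = 0 := by linarith
    have e22 : W 2 2 = 0 := by linarith
    have e33 : W 3 3 = 0 := by linarith
    rw [e00] at d0
    rw [e11, w10] at d1
    rw [e22, w20, w21] at d2
    rw [e33, w30, w31, w32] at d3
    linear_combination a1 s 0 * d0 - a1 s 1 * d1 - a1 s 2 * d2 - a1 s 3 * d3 - deriv p s * h3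
  have hqc : ∀ᶠ s in nhds s0, B4 (a1 s) (a1 s) ≠ 0 :=
    (hasDerivAt_B4 (ha1 s0 hs0) (ha1 s0 hs0)).continuousAt.eventually_ne hq
  have hk0 : ∀ᶠ s in nhds s0, ∀ i, B4 (W i) (a s) = 0 := by
    filter_upwards [hqc, hI.mem_nhds hs0] with s h1 h2 i
    have : p s = 0 := by simpa [h1] using hp0 s h2
    rw [hp s h2, this, zero_mul]
  have hk1 : ∀ᶠ s in nhds s0, ∀ i, B4 (W i) (a1 s) = 0 := by
    filter_upwards [hk0.eventually_nhds, hI.mem_nhds hs0] with s h1 h2 i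
    refine (hasDerivAt_B4_right (W i) (ha s h2)).unique
      ((hasDerivAt_const s (0:ℝ)).congr_of_eventuallyEq ?_)
    filter_upwards [h1] with x hx using hx i
  have hk2 : ∀ i, B4 (W i) (a2 s0) = 0 := by
    intro i
    refine (hasDerivAt_B4_right (W i) (ha1 s0 hs0)).unique
      ((hasDerivAt_const s0 (0:ℝ)).congr_of_eventuallyEq ?_)
    filter_upwards [hk1] with x hx using hx i
  have h02 : B4 (a1 s0) (a1 s0) + B4 (a s0) (a2 s0) = 0 := by
    refine (hasDerivAt_B4 (ha s0 hs0) (ha1 s0 hs0)).unique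
      ((hasDerivAt_const s0 (0:ℝ)).congr_of_eventuallyEq ?_)
    filter_upwards [hI.mem_nhds hs0] with x hx using h01 x hx
  refine antisym_kill W hW (a s0) (a1 s0) (a2 s0) b (hnull s0 hs0) (h01 s0 hs0) ?_ hq
    (hb s0 hs0) hk0.self_of_nhds hk1.self_of_nhds hk2
  intro h; apply hq; linarith

/-- null vector orthogonal to a nonzero null vector is proportional to it -/
theorem null_orth (a c : Fin 4 → ℝ) (ha : B4 a a = 0) (hac : B4 a c = 0) (hc : B4 c c = 0)
    (hne : a 0 ≠ 0) : ∃ k : ℝ, c = k • a := by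
  refine ⟨c 0 / a 0, ?_⟩
  simp only [B4] at *
  have h : (a 0 * c 1 - c 0 * a 1)^2 + (a 0 * c 2 - c 0 * a 2)^2 + (a 0 * c 3 - c 0 * a 3)^2 = 0 := by
    linear_combination (a 0)^2 * hc - 2 * a 0 * c 0 * hac + (c 0)^2 * ha
  have h1 : a 0 * c 1 - c 0 * a 1 = 0 := by nlinarith [sq_nonneg (a 0 * c 1 - c 0 * a 1), sq_nonneg (a 0 * c 2 - c 0 * a 2), sq_nonneg (a 0 * c 3 - c 0 * a 3)]
  have h2 : a 0 * c 2 - c 0 * a 2 = 0 := by nlinarith [sq_nonneg (a 0 * c 1 - c 0 * a 1), sq_nonneg (a 0 * c 2 - c 0 * a 2), sq_nonneg (a 0 * c 3 - c 0 * a 3)]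
  have h3 : a 0 * c 3 - c 0 * a 3 = 0 := by nlinarith [sq_nonneg (a 0 * c 1 - c 0 * a 1), sq_nonneg (a 0 * c 2 - c 0 * a 2), sq_nonneg (a 0 * c 3 - c 0 * a 3)]
  ext i
  fin_cases i <;> simp <;> field_simp <;> linarith

theorem null_zero_ne (a b : Fin 4 → ℝ) (ha : B4 a a = 0) (hab : B4 a b ≠ 0) : a 0 ≠ 0 := by
  intro h
  apply hab
  simp only [B4] at *
  rw [h] at ha ⊢
  have h1 : a 1 = 0 := by nlinarith [sq_nonneg (a 1), sq_nonneg (a 2), sq_nonneg (a 3)]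
  have h2 : a 2 = 0 := by nlinarith [sq_nonneg (a 1), sq_nonneg (a 2), sq_nonneg (a 3)]
  have h3 : a 3 = 0 := by nlinarith [sq_nonneg (a 1), sq_nonneg (a 2), sq_nonneg (a 3)]
  rw [h1, h2, h3]; ring

theorem pd_smooth {I₁ I₂ : Set ℝ} (hI₁ : IsOpen I₁) (hI₂ : IsOpen I₂)
    {ξ : ℝ → ℝ → (Fin 4 → Fin 4 → ℝ)}
    (h : ContDiffOn ℝ (⊤ : ℕ∞) (Function.uncurry ξ) (I₁ ×ˢ I₂)) :
    (∀ s ∈ I₁, ∀ t ∈ I₂, HasDerivAt (fun u => ξ s u) (pdt ξ s t) t) ∧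
    (∀ s ∈ I₁, ∀ t ∈ I₂, HasDerivAt (fun u => pdt ξ u t) (pds (pdt ξ) s t) s) := by
  have hO : IsOpen (I₁ ×ˢ I₂) := hI₁.prod hI₂
  have h1 : ∀ s ∈ I₁, ∀ t ∈ I₂,
      HasDerivAt (fun u => ξ s u) (fderiv ℝ (Function.uncurry ξ) (s, t) (0, 1)) t := by
    intro s hs t ht
    have hd : HasFDerivAt (Function.uncurry ξ) (fderiv ℝ (Function.uncurry ξ) (s, t)) (s, t) :=
      ((h.contDiffAt (hO.mem_nhds ⟨hs, ht⟩)).differentiableAt (by simp)).hasFDerivAt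
    have hc : HasDerivAt (fun u : ℝ => (s, u)) ((0 : ℝ), (1 : ℝ)) t :=
      (hasDerivAt_const t s).prodMk (hasDerivAt_id t)
    exact hd.comp_hasDerivAt t hc
  refine ⟨fun s hs t ht => ?_, fun s hs t ht => ?_⟩
  · exact (h1 s hs t ht).differentiableAt.hasDerivAt
  · have h2 : ContDiffOn ℝ 1 (fderiv ℝ (Function.uncurry ξ)) (I₁ ×ˢ I₂) :=
      h.fderiv_of_isOpen hO (by norm_cast)
    have h3 : DifferentiableAt ℝ (fderiv ℝ (Function.uncurry ξ)) (s, t) :=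
      (h2.contDiffAt (hO.mem_nhds ⟨hs, ht⟩)).differentiableAt (by simp)
    have hc : HasDerivAt (fun u : ℝ => (u, t)) ((1 : ℝ), (0 : ℝ)) s :=
      (hasDerivAt_id s).prodMk (hasDerivAt_const s t)
    have h4 : DifferentiableAt ℝ
        (fun u => fderiv ℝ (Function.uncurry ξ) (u, t) ((0 : ℝ), (1 : ℝ))) s := by
      have h5 : DifferentiableAt ℝ (fun u => fderiv ℝ (Function.uncurry ξ) (u, t)) s :=
        h3.comp s hc.differentiableAt
      exact h5.clm_apply (differentiableAt_const _)
    have h6 : DifferentiableAt ℝ (fun u => pdt ξ u t) s := by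
      refine h4.congr_of_eventuallyEq ?_
      filter_upwards [hI₁.mem_nhds hs] with u hu
      exact (h1 u hu t ht).deriv
    exact h6.hasDerivAt

theorem sep_of_pd_zero {I₁ I₂ : Set ℝ} (hI₁ : IsOpen I₁) (hI₂ : IsOpen I₂)
    (hI₁' : I₁.OrdConnected) (hI₂' : I₂.OrdConnected)
    {ξ : ℝ → ℝ → (Fin 4 → Fin 4 → ℝ)}
    (h1 : ∀ s ∈ I₁, ∀ t ∈ I₂, HasDerivAt (fun u => ξ s u) (pdt ξ s t) t)
    (h2 : ∀ s ∈ I₁, ∀ t ∈ I₂, HasDerivAt (fun u => pdt ξ u t) 0 s)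
    {s s' t t' : ℝ} (hs : s ∈ I₁) (hs' : s' ∈ I₁) (ht : t ∈ I₂) (ht' : t' ∈ I₂) :
    ξ s t - ξ s' t = ξ s t' - ξ s' t' := by
  have hc : ∀ u ∈ I₂, pdt ξ s u = pdt ξ s' u := by
    intro u hu
    exact hI₁.is_const_of_deriv_eq_zero (f := fun v => pdt ξ v u) hI₁'.isPreconnected
      (fun v hv => (h2 v hv u hu).differentiableAt.differentiableWithinAt)
      (fun v hv => (h2 v hv u hu).deriv) hs hs'
  have hd : ∀ u ∈ I₂, HasDerivAt (fun u => ξ s u - ξ s' u) 0 u := by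
    intro u hu
    refine ((h1 s hs u hu).sub (h1 s' hs' u hu)).congr_deriv ?_
    rw [hc u hu, sub_self]
  exact hI₂.is_const_of_deriv_eq_zero (f := fun u => ξ s u - ξ s' u) hI₂'.isPreconnected
      (fun v hv => (hd v hv).differentiableAt.differentiableWithinAt)
      (fun v hv => (hd v hv).deriv) ht ht'

/-- the mixed derivative of the Gauss map -/
def Gst (a b a1 b1 : Fin 4 → ℝ) : Fin 4 → Fin 4 → ℝ := fun i j =>
  -(wedge a1 b1 i j) / B4 a b + B4 a1 b / (B4 a b) ^ 2 * wedge a b1 i j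
    + (B4 a1 b1 / (B4 a b) ^ 2 - 2 * B4 a1 b * B4 a b1 / (B4 a b) ^ 3) * wedge a b i j
    + B4 a b1 / (B4 a b) ^ 2 * wedge a1 b i j

theorem hasDerivAt_wedge_left {u : ℝ → Fin 4 → ℝ} {u' : Fin 4 → ℝ} {s : ℝ}
    (v : Fin 4 → ℝ) (hu : HasDerivAt u u' s) (i j : Fin 4) :
    HasDerivAt (fun x => wedge (u x) v i j) (wedge u' v i j) s := by
  have hu' := hasDerivAt_pi.1 hu
  exact ((hu' i).mul_const (v j)).sub ((hu' j).mul_const (v i))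

theorem hasDerivAt_wedge_right {u : ℝ → Fin 4 → ℝ} {u' : Fin 4 → ℝ} {s : ℝ}
    (v : Fin 4 → ℝ) (hu : HasDerivAt u u' s) (i j : Fin 4) :
    HasDerivAt (fun x => wedge v (u x) i j) (wedge v u' i j) s := by
  have hu' := hasDerivAt_pi.1 hu
  exact ((hu' j).const_mul (v i)).sub ((hu' i).const_mul (v j))

theorem pdt_gauss (α β : ℝ → Fin 4 → ℝ) (s t : ℝ) (b1 : Fin 4 → ℝ)
    (hb : HasDerivAt (deriv β) b1 t) (hne : B4 (deriv α s) (deriv β t) ≠ 0) :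
    pdt (gaussMap α β) s t = fun i j =>
      -(wedge (deriv α s) b1 i j) / B4 (deriv α s) (deriv β t)
      + B4 (deriv α s) b1 / (B4 (deriv α s) (deriv β t)) ^ 2
        * wedge (deriv α s) (deriv β t) i j := by
  refine HasDerivAt.deriv ?_
  refine hasDerivAt_pi.2 fun i => hasDerivAt_pi.2 fun j => ?_
  have h1 := hasDerivAt_B4_right (deriv α s) hb
  have h2 := hasDerivAt_wedge_right (deriv α s) hb i j
  have h3 := (h2.div h1 hne).neg
  have : (fun u => gaussMap α β s u i j) =
      fun u => -(wedge (deriv α s) (deriv β u) i j / B4 (deriv α s) (deriv β u)) := by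
    funext u
    simp only [gaussMap, msq, Pi.smul_apply, smul_eq_mul]
    rw [one_div, inv_neg]; ring
  rw [this]
  refine h3.congr_deriv ?_
  field_simp
  ring

theorem pds_pdt_gauss {I₁ : Set ℝ} (hI₁ : IsOpen I₁) (α β : ℝ → Fin 4 → ℝ) (s t : ℝ) (hs : s ∈ I₁)
    (a1 b1 : Fin 4 → ℝ) (ha : HasDerivAt (deriv α) a1 s)
    (hb : HasDerivAt (deriv β) b1 t) (hne : ∀ s ∈ I₁, B4 (deriv α s) (deriv β t) ≠ 0) :
    pds (pdt (gaussMap α β)) s t = Gst (deriv α s) (deriv β t) a1 b1 := by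
  refine HasDerivAt.deriv ?_
  have hev : (fun u => pdt (gaussMap α β) u t) =ᶠ[nhds s] fun u i j =>
      -(wedge (deriv α u) b1 i j) / B4 (deriv α u) (deriv β t)
      + B4 (deriv α u) b1 / (B4 (deriv α u) (deriv β t)) ^ 2
        * wedge (deriv α u) (deriv β t) i j := by
    filter_upwards [hI₁.mem_nhds hs] with u hu
    exact pdt_gauss α β u t b1 hb (hne u hu)
  refine HasDerivAt.congr_of_eventuallyEq ?_ hev
  refine hasDerivAt_pi.2 fun i => hasDerivAt_pi.2 fun j => ?_
  have hm := hne s hs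
  have h1 := hasDerivAt_B4_left (deriv β t) ha
  have h2 := hasDerivAt_B4_left b1 ha
  have h3 := hasDerivAt_wedge_left (deriv β t) ha i j
  have h4 := hasDerivAt_wedge_left b1 ha i j
  have h5 := (h4.neg.div h1 hm).add ((h2.div (h1.pow 2) (pow_ne_zero 2 hm)).mul h3)
  refine h5.congr_deriv ?_
  simp only [Gst, Pi.neg_apply, Pi.div_apply, Pi.pow_apply]
  field_simp
  ring

theorem Gst_degen_left (a b b1 : Fin 4 → ℝ) (k : ℝ) (hm : B4 a b ≠ 0) :
    Gst a b (k • a) b1 = 0 := by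
  have e : ∀ c, B4 (k • a) c = k * B4 a c := by intro c; simp [B4]; ring
  have w : ∀ c i j, wedge (k • a) c i j = k * wedge a c i j := by
    intro c i j; simp [wedge]; ring
  ext i j
  simp only [Gst, e, w, Pi.zero_apply]
  field_simp
  ring

theorem Gst_degen_right (a b a1 : Fin 4 → ℝ) (k : ℝ) (hm : B4 a b ≠ 0) :
    Gst a b a1 (k • b) = 0 := by
  have e : ∀ c, B4 c (k • b) = k * B4 c b := by intro c; simp [B4]; ring
  have w : ∀ c i j, wedge c (k • b) i j = k * wedge c b i j := by
    intro c i j; simp [wedge]; ring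
  ext i j
  simp only [Gst, e, w, Pi.zero_apply]
  field_simp
  ring

theorem Gst_antisymm (a b a1 b1 : Fin 4 → ℝ) (i j) : Gst a b a1 b1 i j = - Gst a b a1 b1 j i := by
  simp only [Gst, wedge]; ring

theorem B4_wedge (a b c : Fin 4 → ℝ) (i) : B4 (wedge a b i) c = a i * B4 b c - b i * B4 a c := by
  simp only [B4, wedge]; ring

theorem B4_Gst (a b a1 b1 c : Fin 4 → ℝ) (i) : B4 (Gst a b a1 b1 i) c =
  -(B4 (wedge a1 b1 i) c) / B4 a b + B4 a1 b / (B4 a b) ^ 2 * B4 (wedge a b1 i) c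
    + (B4 a1 b1 / (B4 a b) ^ 2 - 2 * B4 a1 b * B4 a b1 / (B4 a b) ^ 3) * B4 (wedge a b i) c
    + B4 a b1 / (B4 a b) ^ 2 * B4 (wedge a1 b i) c := by
  generalize h1 : B4 a b = m
  generalize h2 : B4 a1 b = p
  generalize h3 : B4 a b1 = q
  generalize h4 : B4 a1 b1 = r
  simp only [B4, Gst] at *
  simp only [h1, h2, h3, h4]
  ring

theorem Gst_eig_left (a b a1 b1 : Fin 4 → ℝ) (hm : B4 a b ≠ 0) (ha : B4 a a = 0)
    (ha1 : B4 a a1 = 0) : ∃ c, ∀ i, B4 (Gst a b a1 b1 i) a = c * a i := by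
  refine ⟨B4 a1 b1 / B4 a b - B4 a1 b * B4 a b1 / (B4 a b) ^ 2, fun i => ?_⟩
  rw [B4_Gst]
  simp only [B4_wedge, ha, B4_comm a1 a, ha1, B4_comm b a, B4_comm b1 a]
  field_simp
  ring

theorem Gst_eig_right (a b a1 b1 : Fin 4 → ℝ) (hm : B4 a b ≠ 0) (hb : B4 b b = 0)
    (hb1 : B4 b b1 = 0) : ∃ c, ∀ i, B4 (Gst a b a1 b1 i) b = c * b i := by
  refine ⟨-(B4 a1 b1 / B4 a b - B4 a1 b * B4 a b1 / (B4 a b) ^ 2), fun i => ?_⟩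
  rw [B4_Gst]
  simp only [B4_wedge, hb, B4_comm b1 b, hb1]
  field_simp
  ring

theorem Gst_scalars (a b a1 b1 : Fin 4 → ℝ) (l : ℝ) (hm : B4 a b ≠ 0)
    (ha : B4 a a = 0) (ha1 : B4 a a1 = 0) (hb : B4 b b = 0) (hb1 : B4 b b1 = 0)
    (h : ∀ i j, Gst a b a1 b1 i j = l * wedge a b i j) :
    B4 a1 b1 * B4 a b - B4 a1 b * B4 a b1 = l * (B4 a b) ^ 3 ∧
    B4 a1 a1 * B4 b1 b1 = l ^ 2 * (B4 a b) ^ 4 := by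
  have key : ∀ c d, B4 (fun i => B4 (Gst a b a1 b1 i) c) d
      = l * B4 (fun i => B4 (wedge a b i) c) d := by
    intro c d
    simp only [B4, h]; ring
  have ww : ∀ (x y c d : Fin 4 → ℝ), B4 (fun i => B4 (wedge x y i) c) d
      = B4 x d * B4 y c - B4 y d * B4 x c := by
    intro x y c d
    simp only [B4_wedge]
    generalize B4 y c = u
    generalize B4 x c = v
    simp only [B4]; ring
  have gg : ∀ c d, B4 (fun i => B4 (Gst a b a1 b1 i) c) d =
      -(B4 (fun i => B4 (wedge a1 b1 i) c) d) / B4 a b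
      + B4 a1 b / (B4 a b) ^ 2 * B4 (fun i => B4 (wedge a b1 i) c) d
      + (B4 a1 b1 / (B4 a b) ^ 2 - 2 * B4 a1 b * B4 a b1 / (B4 a b) ^ 3)
        * B4 (fun i => B4 (wedge a b i) c) d
      + B4 a b1 / (B4 a b) ^ 2 * B4 (fun i => B4 (wedge a1 b i) c) d := by
    intro c d
    simp only [B4_Gst]
    generalize B4 a b = m
    generalize B4 a1 b = p
    generalize B4 a b1 = q
    generalize B4 a1 b1 = r
    generalize hx1 : (fun i => B4 (wedge a1 b1 i) c) = x1
    generalize hx2 : (fun i => B4 (wedge a b1 i) c) = x2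
    generalize hx3 : (fun i => B4 (wedge a b i) c) = x3
    generalize hx4 : (fun i => B4 (wedge a1 b i) c) = x4
    have y1 : ∀ i, B4 (wedge a1 b1 i) c = x1 i := fun i => congrFun hx1 i
    have y2 : ∀ i, B4 (wedge a b1 i) c = x2 i := fun i => congrFun hx2 i
    have y3 : ∀ i, B4 (wedge a b i) c = x3 i := fun i => congrFun hx3 i
    have y4 : ∀ i, B4 (wedge a1 b i) c = x4 i := fun i => congrFun hx4 i
    simp only [y1, y2, y3, y4]
    simp only [B4]; ring
  have e1 := key a b
  have e2 := key a1 b1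
  rw [gg] at e1 e2
  simp only [ww, ha, hb, B4_comm a1 a, B4_comm b1 b, B4_comm b a, B4_comm b1 a, B4_comm b a1,
    B4_comm b1 a1, ha1, hb1] at e1 e2
  generalize B4 a b = m at *
  generalize B4 a1 b = p at *
  generalize B4 a b1 = q at *
  generalize B4 a1 b1 = r at *
  generalize B4 a1 a1 = f at *
  generalize B4 b1 b1 = g at *
  simp only [mul_zero, sub_zero, zero_mul, zero_sub] at e1 e2
  have E1 : r * m - p * q = l * m ^ 3 := by
    field_simp at e1
    first
    | linear_combination e1
    | (have : m * (r * m - p * q) = m * (l * m ^ 3) := by linear_combination e1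
       exact mul_left_cancel₀ hm this)
    | (have : m ^ 2 * (r * m - p * q) = m ^ 2 * (l * m ^ 3) := by linear_combination e1
       exact mul_left_cancel₀ (pow_ne_zero 2 hm) this)
  refine ⟨E1, ?_⟩
  have e3 : f * g * m ^ 2 = l * (p * q) * m ^ 3 + r ^ 2 * m ^ 2 - 3 * (r * m * (p * q))
      + 2 * (p * q) ^ 2 := by
    field_simp at e2
    linear_combination e2
  have : m ^ 2 * (f * g) = m ^ 2 * (l ^ 2 * m ^ 4) := by
    linear_combination e3 - p * q * E1 + (r * m - p * q + l * m ^ 3) * E1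
  exact mul_left_cancel₀ (pow_ne_zero 2 hm) this

/-- Corollary 4.4: no minimal Lorentzian surface in `𝔼⁴₁` has null 2-type Gauss map:
there is no decomposition `ν = ν₀ + ν₁ + ν₂` with `ν₀` constant, `ν₁` non-constant
harmonic (`Δν₁ = 0`), and `ν₂` non-constant with `Δν₂ = λ·ν₂` for a constant `λ ≠ 0`. -/
theorem no_null_two_type_gaussMap
    (I₁ I₂ : Set ℝ) (hI₁ : IsOpen I₁) (hI₂ : IsOpen I₂)
    (hI₁' : I₁.OrdConnected) (hI₂' : I₂.OrdConnected)
    (α β : ℝ → Fin 4 → ℝ)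
    (hα : ContDiffOn ℝ (⊤ : ℕ∞) α I₁) (hβ : ContDiffOn ℝ (⊤ : ℕ∞) β I₂)
    (hαnull : ∀ s ∈ I₁, B4 (deriv α s) (deriv α s) = 0)
    (hβnull : ∀ t ∈ I₂, B4 (deriv β t) (deriv β t) = 0)
    (hneg : ∀ s ∈ I₁, ∀ t ∈ I₂, B4 (deriv α s) (deriv β t) < 0)
    :
    ¬ ∃ (ν₀ : Fin 4 → Fin 4 → ℝ) (ν₁ ν₂ : ℝ → ℝ → (Fin 4 → Fin 4 → ℝ)) (lam : ℝ),
      lam ≠ 0 ∧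
      ContDiffOn ℝ (⊤ : ℕ∞) (Function.uncurry ν₁) (I₁ ×ˢ I₂) ∧
      ContDiffOn ℝ (⊤ : ℕ∞) (Function.uncurry ν₂) (I₁ ×ˢ I₂) ∧
      (∀ s ∈ I₁, ∀ t ∈ I₂, gaussMap α β s t = ν₀ + ν₁ s t + ν₂ s t) ∧
      (∀ s ∈ I₁, ∀ t ∈ I₂, lap α β ν₁ s t = 0) ∧
      ¬ (∃ c : Fin 4 → Fin 4 → ℝ, ∀ s ∈ I₁, ∀ t ∈ I₂, ν₁ s t = c) ∧
      (∀ s ∈ I₁, ∀ t ∈ I₂, lap α β ν₂ s t = lam • ν₂ s t) ∧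
      ¬ (∃ c : Fin 4 → Fin 4 → ℝ, ∀ s ∈ I₁, ∀ t ∈ I₂, ν₂ s t = c) := by
  rintro ⟨ν₀, ν₁, ν₂, lam, hlam, hν₁, hν₂, hsum, hL₁, -, hL₂, hnc⟩
  have curve : ∀ (I : Set ℝ) (γ : ℝ → Fin 4 → ℝ), IsOpen I → ContDiffOn ℝ (⊤ : ℕ∞) γ I →
      (∀ s ∈ I, B4 (deriv γ s) (deriv γ s) = 0) →
      (∀ s ∈ I, HasDerivAt (deriv γ) (deriv (deriv γ) s) s) ∧
      (∀ s ∈ I, HasDerivAt (deriv (deriv γ)) (deriv (deriv (deriv γ)) s) s) ∧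
      (∀ s ∈ I, B4 (deriv γ s) (deriv (deriv γ) s) = 0) := by
    intro I γ hI hγ hn
    have c1 : ContDiffOn ℝ (⊤ : ℕ∞) (deriv γ) I := hγ.deriv_of_isOpen hI (by norm_cast)
    have c2 : ContDiffOn ℝ (⊤ : ℕ∞) (deriv (deriv γ)) I := c1.deriv_of_isOpen hI (by norm_cast)
    have d1 : ∀ s ∈ I, HasDerivAt (deriv γ) (deriv (deriv γ) s) s := fun s hs =>
      ((c1.contDiffAt (hI.mem_nhds hs)).differentiableAt (by simp)).hasDerivAt
    refine ⟨d1, fun s hs =>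
      ((c2.contDiffAt (hI.mem_nhds hs)).differentiableAt (by simp)).hasDerivAt, fun s hs => ?_⟩
    have h1 := hasDerivAt_B4 (d1 s hs) (d1 s hs)
    have h2 := h1.unique ((hasDerivAt_const s (0:ℝ)).congr_of_eventuallyEq (by
      filter_upwards [hI.mem_nhds hs] with x hx using hn x hx))
    rw [B4_comm (deriv (deriv γ) s)] at h2
    linarith
  obtain ⟨ha, ha1, ha01⟩ := curve I₁ α hI₁ hα hαnull
  obtain ⟨hb, hb1, hb01⟩ := curve I₂ β hI₂ hβ hβnull
  clear curve
  have hm : ∀ s ∈ I₁, ∀ t ∈ I₂, B4 (deriv α s) (deriv β t) ≠ 0 := fun s hs t ht =>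
    (hneg s hs t ht).ne
  have hμ : ∀ s ∈ I₁, ∀ t ∈ I₂, msq α β s t ≠ 0 := fun s hs t ht => neg_ne_zero.2 (hm s hs t ht)
  obtain ⟨p1, q1⟩ := pd_smooth hI₁ hI₂ hν₁
  obtain ⟨p2, q2⟩ := pd_smooth hI₁ hI₂ hν₂
  have hz1 : ∀ s ∈ I₁, ∀ t ∈ I₂, pds (pdt ν₁) s t = 0 := by
    intro s hs t ht
    have := hL₁ s hs t ht
    simpa [lap, hμ s hs t ht] using this
  have hG : ∀ s ∈ I₁, ∀ t ∈ I₂, pds (pdt ν₂) s t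
      = Gst (deriv α s) (deriv β t) (deriv (deriv α) s) (deriv (deriv β) t) := by
    intro s hs t ht
    rw [← pds_pdt_gauss hI₁ α β s t hs _ _ (ha s hs) (hb t ht) (fun s hs => hm s hs t ht)]
    have h1 : ∀ u ∈ I₁, pdt (gaussMap α β) u t = pdt ν₁ u t + pdt ν₂ u t := by
      intro u hu
      refine HasDerivAt.deriv ?_
      refine (((p1 u hu t ht).const_add ν₀).add (p2 u hu t ht)).congr_of_eventuallyEq ?_
      filter_upwards [hI₂.mem_nhds ht] with x hx using hsum u hu x hx
    symm
    refine HasDerivAt.deriv ?_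
    have h2 := (q1 s hs t ht).add (q2 s hs t ht)
    rw [hz1 s hs t ht, zero_add] at h2
    refine h2.congr_of_eventuallyEq ?_
    filter_upwards [hI₁.mem_nhds hs] with x hx using h1 x hx
  -- ν₂ in terms of Gst
  have h2G : ∀ s ∈ I₁, ∀ t ∈ I₂, ∀ i j, ν₂ s t i j = -(2 / (lam * B4 (deriv α s) (deriv β t))) *
      Gst (deriv α s) (deriv β t) (deriv (deriv α) s) (deriv (deriv β) t) i j := by
    intro s hs t ht i j
    have h := congrFun (congrFun (hL₂ s hs t ht) i) j
    have := hm s hs t ht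
    simp only [lap, hG s hs t ht, msq, Pi.smul_apply, smul_eq_mul] at h
    generalize Gst (deriv α s) (deriv β t) (deriv (deriv α) s) (deriv (deriv β) t) i j = g at *
    generalize B4 (deriv α s) (deriv β t) = m at *
    have h' : ν₂ s t i j = (lam * ν₂ s t i j) / lam := by field_simp
    rw [h', ← h]
    rw [div_neg]
    field_simp
  have hzero : (∀ s ∈ I₁, ∀ t ∈ I₂, Gst (deriv α s) (deriv β t) (deriv (deriv α) s)
      (deriv (deriv β) t) = 0) → False := by
    intro h
    refine hnc ⟨0, fun s hs t ht => ?_⟩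
    ext i j
    rw [h2G s hs t ht, h s hs t ht]; simp
  by_cases hA : ∀ s ∈ I₁, B4 (deriv (deriv α) s) (deriv (deriv α) s) = 0
  · refine hzero fun s hs t ht => ?_
    obtain ⟨k, hk⟩ := null_orth _ _ (hαnull s hs) (ha01 s hs) (hA s hs)
      (null_zero_ne _ _ (hαnull s hs) (hm s hs t ht))
    rw [hk]
    exact Gst_degen_left _ _ _ _ (hm s hs t ht)
  by_cases hB : ∀ t ∈ I₂, B4 (deriv (deriv β) t) (deriv (deriv β) t) = 0
  · refine hzero fun s hs t ht => ?_
    obtain ⟨k, hk⟩ := null_orth _ _ (hβnull t ht) (hb01 t ht) (hB t ht)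
      (null_zero_ne _ (deriv α s) (hβnull t ht) (by rw [B4_comm]; exact hm s hs t ht))
    rw [hk]
    exact Gst_degen_right _ _ _ _ (hm s hs t ht)
  push Not at hA hB
  obtain ⟨s0, hs0, hqs⟩ := hA
  obtain ⟨t0, ht0, hqt⟩ := hB
  have hV : ∀ s ∈ I₁, ∀ t ∈ I₂, ∀ i j, (ν₀ + ν₁ s t) i j =
      -(1 / B4 (deriv α s) (deriv β t)) * wedge (deriv α s) (deriv β t) i j
      + (2 / (lam * B4 (deriv α s) (deriv β t))) *
      Gst (deriv α s) (deriv β t) (deriv (deriv α) s) (deriv (deriv β) t) i j := by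
    intro s hs t ht i j
    have h := congrFun (congrFun (hsum s hs t ht) i) j
    have h2 := h2G s hs t ht i j
    simp only [gaussMap, msq, Pi.smul_apply, smul_eq_mul, Pi.add_apply] at h ⊢
    rw [div_neg] at h
    linear_combination -h - h2
  have hVB : ∀ s ∈ I₁, ∀ t ∈ I₂, ∀ i c, B4 ((ν₀ + ν₁ s t) i) c =
      -(1 / B4 (deriv α s) (deriv β t)) * B4 (wedge (deriv α s) (deriv β t) i) c
      + (2 / (lam * B4 (deriv α s) (deriv β t))) *
      B4 (Gst (deriv α s) (deriv β t) (deriv (deriv α) s) (deriv (deriv β) t) i) c := by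
    intro s hs t ht i c
    have h := hV s hs t ht i
    generalize (ν₀ + ν₁ s t) i = v at *
    generalize Gst (deriv α s) (deriv β t) (deriv (deriv α) s) (deriv (deriv β) t) i = g at *
    generalize wedge (deriv α s) (deriv β t) i = w at *
    generalize -(1 / B4 (deriv α s) (deriv β t)) = x at *
    generalize (2 / (lam * B4 (deriv α s) (deriv β t))) = y at *
    simp only [B4, h]; ring
  have hVanti : ∀ s ∈ I₁, ∀ t ∈ I₂, ∀ i j, (ν₀ + ν₁ s t) i j = -(ν₀ + ν₁ s t) j i := by
    intro s hs t ht i j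
    rw [hV s hs t ht, hV s hs t ht, Gst_antisymm _ _ _ _ i j]
    simp only [wedge]; ring
  have hVa : ∀ s ∈ I₁, ∀ t ∈ I₂, ∃ c, ∀ i, B4 ((ν₀ + ν₁ s t) i) (deriv α s) = c * deriv α s i := by
    intro s hs t ht
    obtain ⟨c, hc⟩ := Gst_eig_left _ _ _ (deriv (deriv β) t) (hm s hs t ht) (hαnull s hs)
      (ha01 s hs)
    refine ⟨-(1 / B4 (deriv α s) (deriv β t)) * B4 (deriv β t) (deriv α s) +
      (2 / (lam * B4 (deriv α s) (deriv β t))) * c, fun i => ?_⟩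
    rw [hVB s hs t ht, hc, B4_wedge, hαnull s hs]
    ring
  have hVb : ∀ s ∈ I₁, ∀ t ∈ I₂, ∃ c, ∀ i, B4 ((ν₀ + ν₁ s t) i) (deriv β t) = c * deriv β t i := by
    intro s hs t ht
    obtain ⟨c, hc⟩ := Gst_eig_right _ _ (deriv (deriv α) s) _ (hm s hs t ht) (hβnull t ht)
      (hb01 t ht)
    refine ⟨(1 / B4 (deriv α s) (deriv β t)) * B4 (deriv α s) (deriv β t) +
      (2 / (lam * B4 (deriv α s) (deriv β t))) * c, fun i => ?_⟩
    rw [hVB s hs t ht, hc, B4_wedge, hβnull t ht]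
    ring
  have hsep : ∀ s ∈ I₁, ∀ s' ∈ I₁, ∀ t ∈ I₂, ∀ t' ∈ I₂, ∀ i j,
      ν₁ s t i j - ν₁ s' t i j = ν₁ s t' i j - ν₁ s' t' i j := by
    intro s hs s' hs' t ht t' ht' i j
    have := sep_of_pd_zero hI₁ hI₂ hI₁' hI₂' p1
      (fun s hs t ht => by have := q1 s hs t ht; rwa [hz1 s hs t ht] at this) hs hs' ht ht'
    exact congrFun (congrFun this i) j
  have hBsub : ∀ (u v c : Fin 4 → ℝ), B4 (u - v) c = B4 u c - B4 v c := by
    intro u v c; simp only [B4, Pi.sub_apply]; ring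
  -- V is independent of t
  have hct : ∀ t ∈ I₂, ∀ t' ∈ I₂, ∀ s ∈ I₁, ν₀ + ν₁ s t = ν₀ + ν₁ s t' := by
    intro t ht t' ht' s hs
    rw [← sub_eq_zero]
    refine kill_family I₁ hI₁ (deriv α) _ _ ha ha1 hαnull (deriv β t0)
      (fun s hs => hm s hs t0 ht0) ha01 _ ?_ ?_ s0 hs0 hqs
    · intro i j
      have h1 := hVanti s hs t ht i j
      have h2 := hVanti s hs t' ht' i j
      rw [Pi.sub_apply, Pi.sub_apply, Pi.sub_apply, Pi.sub_apply]
      linear_combination h1 - h2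
    · intro u hu
      obtain ⟨c, hc⟩ := hVa u hu t ht
      obtain ⟨c', hc'⟩ := hVa u hu t' ht'
      have he : (ν₀ + ν₁ s t) - (ν₀ + ν₁ s t') = (ν₀ + ν₁ u t) - (ν₀ + ν₁ u t') := by
        ext i j
        have := hsep s hs u hu t ht t' ht' i j
        simp only [Pi.sub_apply, Pi.add_apply]
        linear_combination this
      refine ⟨c - c', fun i => ?_⟩
      rw [he, Pi.sub_apply, hBsub, hc, hc']; ring
  have hcs : ∀ s ∈ I₁, ∀ s' ∈ I₁, ∀ t ∈ I₂, ν₀ + ν₁ s t = ν₀ + ν₁ s' t := by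
    intro s hs s' hs' t ht
    rw [← sub_eq_zero]
    refine kill_family I₂ hI₂ (deriv β) _ _ hb hb1 hβnull (deriv α s0)
      (fun t ht => by rw [B4_comm]; exact hm s0 hs0 t ht) hb01 _ ?_ ?_ t0 ht0 hqt
    · intro i j
      have h1 := hVanti s hs t ht i j
      have h2 := hVanti s' hs' t ht i j
      rw [Pi.sub_apply, Pi.sub_apply, Pi.sub_apply, Pi.sub_apply]
      linear_combination h1 - h2
    · intro u hu
      obtain ⟨c, hc⟩ := hVb s hs u hu
      obtain ⟨c', hc'⟩ := hVb s' hs' u hu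
      have he : (ν₀ + ν₁ s t) - (ν₀ + ν₁ s' t) = (ν₀ + ν₁ s u) - (ν₀ + ν₁ s' u) := by
        ext i j
        have := hsep s hs s' hs' t ht u hu i j
        simp only [Pi.sub_apply, Pi.add_apply]
        linear_combination this
      refine ⟨c - c', fun i => ?_⟩
      rw [he, Pi.sub_apply, hBsub, hc, hc']; ring
  have hV0 : ∀ s ∈ I₁, ∀ t ∈ I₂, ν₀ + ν₁ s t = 0 := by
    intro s hs t ht
    refine kill_family I₁ hI₁ (deriv α) _ _ ha ha1 hαnull (deriv β t0)
      (fun s hs => hm s hs t0 ht0) ha01 _ (hVanti s hs t ht) ?_ s0 hs0 hqs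
    intro u hu
    rw [hcs s hs u hu t ht]
    exact hVa u hu t ht
  have hfin : ∀ s ∈ I₁, ∀ t ∈ I₂, _ := fun s hs t ht =>
    Gst_scalars (deriv α s) (deriv β t) (deriv (deriv α) s) (deriv (deriv β) t) (lam / 2)
      (hm s hs t ht) (hαnull s hs) (ha01 s hs) (hβnull t ht) (hb01 t ht) (by
        intro i j
        have h := hV s hs t ht i j
        rw [hV0 s hs t ht] at h
        have := hm s hs t ht
        simp only [Pi.zero_apply] at h
        generalize Gst (deriv α s) (deriv β t) (deriv (deriv α) s) (deriv (deriv β) t) i j = g at *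
        generalize B4 (deriv α s) (deriv β t) = m at *
        field_simp at h
        linarith)
  have hmul : ∀ s ∈ I₁, ∀ t ∈ I₂, B4 (deriv α s) (deriv β t) * B4 (deriv α s0) (deriv β t0)
      = B4 (deriv α s) (deriv β t0) * B4 (deriv α s0) (deriv β t) := by
    intro s hs t ht
    have e1 := (hfin s hs t ht).2
    have e2 := (hfin s0 hs0 t0 ht0).2
    have e3 := (hfin s hs t0 ht0).2
    have e4 := (hfin s0 hs0 t ht).2
    have n1 := hneg s hs t ht
    have n2 := hneg s0 hs0 t0 ht0
    have n3 := hneg s hs t0 ht0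
    have n4 := hneg s0 hs0 t ht
    generalize B4 (deriv α s) (deriv β t) = m1 at *
    generalize B4 (deriv α s0) (deriv β t0) = m2 at *
    generalize B4 (deriv α s) (deriv β t0) = m3 at *
    generalize B4 (deriv α s0) (deriv β t) = m4 at *
    have hl : (lam / 2) ^ 4 ≠ 0 := pow_ne_zero _ (div_ne_zero hlam two_ne_zero)
    have h : (lam / 2) ^ 4 * (m1 * m2) ^ 4 = (lam / 2) ^ 4 * (m3 * m4) ^ 4 := by
      calc _ = ((lam / 2) ^ 2 * m1 ^ 4) * ((lam / 2) ^ 2 * m2 ^ 4) := by ring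
        _ = ((lam / 2) ^ 2 * m3 ^ 4) * ((lam / 2) ^ 2 * m4 ^ 4) := by
          rw [← e1, ← e2, ← e3, ← e4]; ring
        _ = _ := by ring
    have h' := mul_left_cancel₀ hl h
    exact (pow_left_inj₀ (mul_pos_of_neg_of_neg n1 n2).le (mul_pos_of_neg_of_neg n3 n4).le
      (by norm_num)).1 h'
  have hmul1 : ∀ t ∈ I₂, B4 (deriv (deriv α) s0) (deriv β t) * B4 (deriv α s0) (deriv β t0)
      = B4 (deriv (deriv α) s0) (deriv β t0) * B4 (deriv α s0) (deriv β t) := by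
    intro t ht
    have h1 := (hasDerivAt_B4_left (deriv β t) (ha s0 hs0)).mul_const
      (B4 (deriv α s0) (deriv β t0))
    have h2 := (hasDerivAt_B4_left (deriv β t0) (ha s0 hs0)).mul_const
      (B4 (deriv α s0) (deriv β t))
    refine h1.unique (h2.congr_of_eventuallyEq ?_)
    filter_upwards [hI₁.mem_nhds hs0] with x hx using hmul x hx t ht
  have hmul2 : B4 (deriv (deriv α) s0) (deriv (deriv β) t0) * B4 (deriv α s0) (deriv β t0)
      = B4 (deriv (deriv α) s0) (deriv β t0) * B4 (deriv α s0) (deriv (deriv β) t0) := by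
    have h1 := (hasDerivAt_B4_right (deriv (deriv α) s0) (hb t0 ht0)).mul_const
      (B4 (deriv α s0) (deriv β t0))
    have h2 := (hasDerivAt_B4_right (deriv α s0) (hb t0 ht0)).const_mul
      (B4 (deriv (deriv α) s0) (deriv β t0))
    refine h1.unique (h2.congr_of_eventuallyEq ?_)
    filter_upwards [hI₂.mem_nhds ht0] with x hx using hmul1 x hx
  have hlast := (hfin s0 hs0 t0 ht0).1
  rw [hmul2, sub_self] at hlast
  exact mul_ne_zero (div_ne_zero hlam two_ne_zero) (pow_ne_zero 3 (hm s0 hs0 t0 ht0)) hlast.symm
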